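/- Mixed-type terminating balanced ₃φ₂ summation (Milne–Lilly): Let n be a positive integer, N a nonnegative integer, q a nonzero complex number that is not a root of unity, and a_1, …, a_n, b, x_1, …, x_n nonzero complex numbers, generic so that no denominator below vanishes. Then ∑_{k_1,…,k_n ≥ 0, |k| ≤ N} [ ∏_{1≤i<j≤n} (x_i·q^{k_i} − x_j·q^{k_j})/(x_i − x_j) · 1/(x_i·x_j; q)_{k_i+k_j} · ∏_{i,j=1}^n (a_j·x_i/x_j; q)_{k_i}·(x_i·x_j/a_j; q)_{k_i} / (q·x_i/x_j; q)_{k_i} · (q^{−N}; q)_{|k|} / ∏_{i=1}^n [ (b·x_i·q^{−N}; q)_{k_i}·(q·x_i/b; q)_{k_i} ] · q^{|k|} ] = ∏_{i=1}^n (q·a_i/(b·x_i); q)_N·(q·x_i/(a_i·b); q)_N / [ (q/(b·x_i); q)_N·(q·x_i/b; q)_N ], where |k| = k_1 + ⋯ + k_n. -/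

import Mathlib

open Finset

/-- The q-shifted factorial `(a;q)_k`. -/
noncomputable def qPoch (q a : ℂ) (k : ℕ) : ℂ := ∏ i ∈ Finset.range k, (1 - a * q ^ i)

theorem qPoch_zero (q a : ℂ) : qPoch q a 0 = 1 := by simp [qPoch]

theorem qPoch_succ (q a : ℂ) (k : ℕ) : qPoch q a (k + 1) = qPoch q a k * (1 - a * q ^ k) := by
  simp [qPoch, prod_range_succ]

theorem qPoch_succ' (q a : ℂ) (k : ℕ) : qPoch q a (k + 1) = (1 - a) * qPoch q (a * q) k := by
  simp only [qPoch, prod_range_succ', pow_zero, mul_one, mul_comm (1 - a)]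
  congr 1
  exact prod_congr rfl fun i _ => by ring

theorem qPoch_ne_zero_iff {q a : ℂ} {k : ℕ} :
    qPoch q a k ≠ 0 ↔ ∀ i < k, a * q ^ i ≠ 1 := by
  simp only [qPoch, prod_ne_zero_iff, mem_range, sub_ne_zero]
  exact forall₂_congr fun i _ => ne_comm

/-- Lagrange interpolation of a monic polynomial of degree `n` at `n` nodes. -/
theorem prod_sub_eq_lagrange {ι : Type*} [Fintype ι] [DecidableEq ι] (t y : ι → ℂ)
    (ht : Function.Injective t) (s : ℂ) :
    ∏ j, (s - y j) = ∏ j, (s - t j) +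
      ∑ i, (∏ j, (t i - y j)) * ∏ j ∈ univ.erase i, (s - t j) / (t i - t j) := by
  have hdeg : (Lagrange.nodal univ y - Lagrange.nodal univ t).degree
      < ((univ : Finset ι).card : WithBot ℕ) := by
    rw [← Lagrange.degree_nodal (s := univ) (v := y)]
    refine Polynomial.degree_sub_lt_left ?_ (Lagrange.nodal_monic).ne_zero ?_
    · rw [Lagrange.degree_nodal, Lagrange.degree_nodal]
    · rw [(Lagrange.nodal_monic).leadingCoeff, (Lagrange.nodal_monic).leadingCoeff]
  have h := congrArg (Polynomial.eval s)
    (Lagrange.eq_interpolate (s := univ) (v := t) ht.injOn hdeg)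
  simp only [Polynomial.eval_sub, Lagrange.eval_nodal, Lagrange.interpolate_apply,
    Polynomial.eval_finsetSum, Polynomial.eval_mul, Polynomial.eval_C] at h
  rw [sub_eq_iff_eq_add'] at h
  rw [h]
  congr 1
  refine sum_congr rfl fun i _ => ?_
  rw [prod_eq_zero (f := fun j => t i - t j) (mem_univ i) (sub_self _), sub_zero, Lagrange.basis,
    Polynomial.eval_prod]
  congr 1
  refine prod_congr rfl fun j _ => ?_
  simp only [Lagrange.basisDivisor, Polynomial.eval_mul, Polynomial.eval_sub, Polynomial.eval_C,
    Polynomial.eval_X]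
  rw [div_eq_inv_mul]

section Interpolation

variable {ι : Type*} [Fintype ι] [DecidableEq ι]

theorem prod_quadratic_expansion (z c : ι → ℂ) (v : ℂ) (hv : v ≠ 0) (hz : ∀ i, z i ≠ 0)
    (hc : ∀ i, c i ≠ 0) (hzz : ∀ i j, i ≠ j → z i ≠ z j) (hzz' : ∀ i j, i ≠ j → z i * z j ≠ 1) :
    ∏ j, ((1 - c j * v) * (1 - v / c j)) = ∏ j, ((1 - v * z j) * (1 - v / z j)) +
      ∑ i, (v / z i * ∏ j ∈ univ.erase i,
        ((1 - v * z j) * (z j - v) / ((z j - z i) * (1 - z i * z j)))) *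
        ∏ j, ((1 - c j * z i) * (1 - z i / c j)) := by
  have key : ∀ i j, z i + (z i)⁻¹ - (z j + (z j)⁻¹) =
      (z j - z i) * (1 - z i * z j) / (z i * z j) := fun i j => by
    have := hz i; have := hz j; field_simp; ring
  have hinj : Function.Injective fun i => z i + (z i)⁻¹ := by
    intro i j hij
    by_contra hne
    have h0 := key i j
    rw [sub_eq_zero.mpr hij, eq_comm, div_eq_zero_iff] at h0
    rcases h0 with h0 | h0
    · rcases mul_eq_zero.mp h0 with h0 | h0
      · exact hzz _ _ hne (sub_eq_zero.mp h0).symm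
      · exact hzz' _ _ hne (sub_eq_zero.mp h0).symm
    · exact mul_ne_zero (hz i) (hz j) h0
  have h := congrArg (fun w => (∏ _j : ι, v) * w)
    (prod_sub_eq_lagrange (fun i => z i + (z i)⁻¹) (fun j => c j + (c j)⁻¹) hinj (v + v⁻¹))
  simp only [mul_add, mul_sum, ← prod_mul_distrib] at h
  convert h using 1
  · refine prod_congr rfl fun j _ => ?_
    have := hc j; field_simp; ring
  · congr 1
    · refine prod_congr rfl fun j _ => ?_
      have := hz j; field_simp; ring
    · refine sum_congr rfl fun i _ => ?_
      rw [← mul_assoc, ← prod_mul_distrib, ← mul_prod_erase univ _ (mem_univ i),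
        ← mul_prod_erase univ (fun j => v * _) (mem_univ i), mul_mul_mul_comm,
        mul_assoc (v * _), ← prod_mul_distrib, ← prod_mul_distrib]
      congr 1
      · have := hc i; have := hz i; field_simp; ring
      · refine prod_congr rfl fun j hj => ?_
        have h1 := sub_ne_zero.mpr (hzz j i (ne_of_mem_erase hj))
        have h2 := sub_ne_zero.mpr (hzz' i j (ne_of_mem_erase hj).symm).symm
        have := hc j; have := hz i; have := hz j
        rw [key]
        field_simp
        ring

theorem prod_linear_expansion (z x : ι → ℂ) (v Q R : ℂ) (hv : v ≠ 0) (hz : ∀ i, z i ≠ 0)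
    (hzz : ∀ i j, i ≠ j → z i ≠ z j) (hR : ∏ j, x j = R * ∏ j, z j) :
    (1 - Q) * ∏ j, (1 - v * x j) = (R - Q) * ∏ j, (1 - v * z j) +
      ∑ i, (∏ j, (z i - x j)) / (z i * ∏ j ∈ univ.erase i, (z i - z j)) * (1 - v * z i * Q) *
        ∏ j ∈ univ.erase i, (1 - v * z j) := by
  have hinj : Function.Injective z := fun i j hij => by
    by_contra hne; exact hzz _ _ hne hij
  set E : ι → ℂ := fun i => (∏ j, (z i - x j)) / (z i * ∏ j ∈ univ.erase i, (z i - z j)) with hE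
  have hEz : ∀ i, ∏ j, (z i - x j) = E i * z i * ∏ j ∈ univ.erase i, (z i - z j) := fun i => by
    have h1 := hz i
    have h2 : ∏ j ∈ univ.erase i, (z i - z j) ≠ 0 :=
      prod_ne_zero_iff.mpr fun j hj => sub_ne_zero.mpr (hzz i j (ne_of_mem_erase hj).symm)
    simp only [hE]; field_simp
  have hlag : ∀ s, ∏ j, (s - x j) = ∏ j, (s - z j) +
      ∑ i, E i * z i * ∏ j ∈ univ.erase i, (s - z j) := fun s => by
    rw [prod_sub_eq_lagrange z x hinj s]
    congr 1
    refine sum_congr rfl fun i _ => ?_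
    rw [hEz, mul_assoc, ← prod_mul_distrib]
    congr 1
    refine prod_congr rfl fun j hj => ?_
    have := sub_ne_zero.mpr (hzz i j (ne_of_mem_erase hj).symm)
    field_simp
  have hsum : ∑ i, E i = 1 - R := by
    have h0 := congrArg (fun w => (∏ _j : ι, (-1 : ℂ)) * w) (hlag 0)
    simp only [mul_add, mul_sum, ← prod_mul_distrib] at h0
    have hZ : ∏ j, z j ≠ 0 := prod_ne_zero_iff.mpr fun j _ => hz j
    have : ∀ i, (∏ _j : ι, (-1 : ℂ)) * (E i * z i * ∏ j ∈ univ.erase i, (0 - z j)) =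
        -E i * ∏ j, z j := fun i => by
      rw [← mul_prod_erase univ _ (mem_univ i), ← mul_prod_erase univ z (mem_univ i)]
      have : ∏ j ∈ univ.erase i, z j =
          (∏ j ∈ univ.erase i, (-1 : ℂ)) * ∏ j ∈ univ.erase i, (0 - z j) := by
        rw [← prod_mul_distrib]; exact prod_congr rfl fun j _ => by ring
      rw [this]; ring
    simp only [this, ← sum_mul, sum_neg_distrib] at h0
    simp only [zero_sub, neg_mul_neg, one_mul, hR] at h0
    have h1 : (R - (1 - ∑ i, E i)) * ∏ j, z j = 0 := by linear_combination h0
    have h2 := (mul_eq_zero.mp h1).resolve_right hZ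
    linear_combination h2
  have hmain : ∏ j, (1 - v * x j) = ∏ j, (1 - v * z j) +
      ∑ i, v * z i * E i * ∏ j ∈ univ.erase i, (1 - v * z j) := by
    have h0 := congrArg (fun w => (∏ _j : ι, v) * w) (hlag v⁻¹)
    simp only [mul_add, mul_sum, ← prod_mul_distrib] at h0
    have hs : ∀ w, v * (v⁻¹ - w) = 1 - v * w := fun w => by field_simp
    simp only [hs] at h0
    rw [h0]
    congr 1
    refine sum_congr rfl fun i _ => ?_
    rw [← mul_prod_erase univ _ (mem_univ i)]
    simp only [← hs, prod_mul_distrib]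
    ring
  have hterm : ∀ i, E i * (1 - v * z i * Q) * ∏ j ∈ univ.erase i, (1 - v * z j) =
      E i * ∏ j, (1 - v * z j) +
        (1 - Q) * (v * z i * E i * ∏ j ∈ univ.erase i, (1 - v * z j)) := fun i => by
    rw [← mul_prod_erase univ (fun j => 1 - v * z j) (mem_univ i)]; ring
  rw [sum_congr rfl fun i _ => hterm i, sum_add_distrib, ← sum_mul, ← mul_sum, hsum, hmain]
  ring

end Interpolation

theorem prod_lt_mul_single {n : ℕ} (ψ φ : Fin n → Fin n → ℂ) (r : Fin n → ℂ) (i : Fin n)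
    (hl : ∀ j, i < j → φ i j = ψ i j * r j) (hr : ∀ j, j < i → φ j i = ψ j i * r j)
    (h : ∀ j l, j ≠ i → l ≠ i → φ j l = ψ j l) :
    ∏ j, ∏ l, (if j < l then φ j l else 1) =
      (∏ j, ∏ l, if j < l then ψ j l else 1) * ∏ j ∈ univ.erase i, r j := by
  have hfac : ∀ j l, (if j < l then φ j l else 1) = (if j < l then ψ j l else 1) *
      ((if j = i then (if i < l then r l else 1) else 1) *
        (if l = i then (if j < i then r j else 1) else 1)) := fun j l => by
    by_cases hjl : j < l
    · by_cases hj : j = i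
      · subst hj; simp [hjl, hl l hjl, hjl.ne']
      · by_cases hli : l = i
        · subst hli; simp [hjl, hr j hjl, hj]
        · simp [hjl, hj, hli, h j l hj hli]
    · by_cases hj : j = i
      · subst hj; simp [hjl]
      · by_cases hli : l = i
        · subst hli; simp [hjl, hj]
        · simp [hjl, hj, hli]
  simp only [hfac, prod_mul_distrib]
  congr 1
  have h1 : ∏ j, ∏ l, (if j = i then (if i < l then r l else 1) else 1) =
      ∏ l, if i < l then r l else 1 := by
    rw [prod_eq_single i (fun j _ hj => by simp [hj]) (by simp)]
    simp
  have h2 : ∏ j, ∏ l, (if l = i then (if j < i then r j else 1) else 1) =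
      ∏ j, if j < i then r j else 1 := by
    simp
  rw [h1, h2, ← prod_mul_distrib, ← mul_prod_erase univ _ (mem_univ i)]
  simp only [lt_irrefl, if_false, one_mul]
  refine prod_congr rfl fun j hj => ?_
  rcases lt_trichotomy i j with hij | hij | hij
  · simp [hij, hij.not_gt]
  · exact absurd hij.symm (ne_of_mem_erase hj)
  · simp [hij, hij.not_gt]

theorem prod_add_single {n : ℕ} (φ : Fin n → ℕ → ℂ) (k : Fin n → ℕ) (i : Fin n) :
    ∏ j, φ j ((k + Pi.single i 1 : Fin n → ℕ) j) = φ i (k i + 1) *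
      ∏ j ∈ univ.erase i, φ j (k j) := by
  rw [← mul_prod_erase univ _ (mem_univ i)]
  congr 1
  · simp
  · exact prod_congr rfl fun j hj => by simp [ne_of_mem_erase hj]

theorem sum_add_single {n : ℕ} (k : Fin n → ℕ) (i : Fin n) :
    ∑ j, (k + Pi.single i 1 : Fin n → ℕ) j = ∑ j, k j + 1 := by
  simp [sum_add_distrib]

/-- The part of the summand depending only on `x`. -/
noncomputable def vandermondeWeight {n : ℕ} (q : ℂ) (x : Fin n → ℂ) (k : Fin n → ℕ) : ℂ :=
  (∏ i, ∏ j, if i < j then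
      (x i * q ^ k i - x j * q ^ k j) / (x i - x j) *
        (qPoch q (x i * x j) (k i + k j))⁻¹ else 1) *
    ∏ i, ∏ j, (qPoch q (q * x i / x j) (k i))⁻¹

/-- The contribution of one coordinate to the `b`-dependent part of the summand, multiplied by the
denominator of the right-hand side. -/
noncomputable def balancedFactor (q b : ℂ) (N : ℕ) (x : ℂ) (m : ℕ) : ℂ :=
  qPoch q (q / (b * x)) N * qPoch q (q * x / b) N /
    (qPoch q (b * x * q ^ (-(N : ℤ))) m * qPoch q (q * x / b) m)

/-- The part of the summand depending on `b` and `N`, multiplied by the denominator of the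
right-hand side. -/
noncomputable def balancedWeight {n : ℕ} (q b : ℂ) (N : ℕ) (x : Fin n → ℂ) (k : Fin n → ℕ) : ℂ :=
  qPoch q (q ^ (-(N : ℤ))) (∑ i, k i) * q ^ (∑ i, k i) * ∏ j, balancedFactor q b N (x j) (k j)

/-- The basis of symmetric Laurent polynomials in `c` in which the right-hand side is expanded. -/
noncomputable def symmetricBasis {n : ℕ} (q : ℂ) (x c : Fin n → ℂ) (k : Fin n → ℕ) : ℂ :=
  ∏ i, ∏ j, qPoch q (c j * x i) (k i) * qPoch q (x i / c j) (k i)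

theorem symmetricBasis_add_single {n : ℕ} (q : ℂ) (x c : Fin n → ℂ) (k : Fin n → ℕ) (i : Fin n) :
    symmetricBasis q x c (k + Pi.single i 1) = symmetricBasis q x c k *
      ∏ j, ((1 - c j * (x i * q ^ k i)) * (1 - x i * q ^ k i / c j)) := by
  unfold symmetricBasis
  rw [prod_add_single (fun i m => ∏ j, qPoch q (c j * x i) m * qPoch q (x i / c j) m),
    ← mul_prod_erase univ (fun i => ∏ j, qPoch q (c j * x i) (k i) * qPoch q (x i / c j) (k i))
      (mem_univ i), mul_right_comm, ← prod_mul_distrib]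
  congr 1
  refine prod_congr rfl fun j _ => ?_
  rw [qPoch_succ, qPoch_succ]
  ring

theorem vandermondeWeight_add_single {n : ℕ} (q : ℂ) (x : Fin n → ℂ) (k : Fin n → ℕ) (i : Fin n)
    (hz : ∀ j, j ≠ i → x i * q ^ k i ≠ x j * q ^ k j) :
    vandermondeWeight q x (k + Pi.single i 1) = vandermondeWeight q x k *
      (∏ j ∈ univ.erase i, (x i * q ^ (k i + 1) - x j * q ^ k j) /
        ((x i * q ^ k i - x j * q ^ k j) * (1 - x i * q ^ k i * (x j * q ^ k j)))) *
      (∏ j, (1 - x i * q ^ (k i + 1) / x j))⁻¹ := by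
  unfold vandermondeWeight
  rw [prod_lt_mul_single
    (fun i j => (x i * q ^ k i - x j * q ^ k j) / (x i - x j) *
        (qPoch q (x i * x j) (k i + k j))⁻¹) _
    (fun j => (x i * q ^ (k i + 1) - x j * q ^ k j) /
        ((x i * q ^ k i - x j * q ^ k j) * (1 - x i * q ^ k i * (x j * q ^ k j)))) i,
    prod_add_single (fun i m => ∏ j, (qPoch q (q * x i / x j) m)⁻¹),
    ← mul_prod_erase univ (fun i => ∏ j, (qPoch q (q * x i / x j) (k i))⁻¹) (mem_univ i)]
  · have : ∏ j, (qPoch q (q * x i / x j) (k i + 1))⁻¹ =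
        (∏ j, (qPoch q (q * x i / x j) (k i))⁻¹) * (∏ j, (1 - x i * q ^ (k i + 1) / x j))⁻¹ := by
      rw [← prod_inv_distrib, ← prod_mul_distrib]
      refine prod_congr rfl fun j _ => ?_
      rw [qPoch_succ, mul_inv, pow_succ]
      congr 3
      ring
    rw [this]
    ring
  · intro j hj
    have h1 := sub_ne_zero.mpr (hz j hj.ne')
    have h2 : k i + 1 + k j = k i + k j + 1 := by ring
    simp only [Pi.add_apply, Pi.single_eq_same, Pi.single_eq_of_ne hj.ne', add_zero, h2,
      qPoch_succ, mul_inv, div_eq_mul_inv]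
    have h3 : x i * x j * q ^ (k i + k j) = x i * q ^ k i * (x j * q ^ k j) := by
      rw [pow_add]; ring
    rw [h3]
    field_simp
  · intro j hj
    have h1 := sub_ne_zero.mpr (hz j hj.ne)
    have h2 : k j + (k i + 1) = k i + k j + 1 := by ring
    simp only [Pi.add_apply, Pi.single_eq_same, Pi.single_eq_of_ne hj.ne, add_zero, h2,
      qPoch_succ, mul_inv, div_eq_mul_inv]
    have h3 : x j * x i * q ^ (k i + k j) = x i * q ^ k i * (x j * q ^ k j) := by
      rw [pow_add]; ring
    have h4 : (x j - x i)⁻¹ = -(x i - x j)⁻¹ := by rw [← neg_sub, inv_neg]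
    rw [h3, h4, add_comm (k j)]
    field_simp
    ring
  · intro j l hj hl
    simp [Pi.single_eq_of_ne hj, Pi.single_eq_of_ne hl]

theorem qPoch_mul_neg_zpow_succ (q y : ℂ) (N m : ℕ) (hq : q ≠ 0) :
    qPoch q (y * q ^ (-((N + 1 : ℕ) : ℤ))) (m + 1) =
      (1 - y / q ^ (N + 1)) * qPoch q (y * q ^ (-(N : ℤ))) m := by
  rw [qPoch_succ']
  have h1 : y * q ^ (-((N + 1 : ℕ) : ℤ)) = y / q ^ (N + 1) := by
    rw [zpow_neg, zpow_natCast, div_eq_mul_inv]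
  have h2 : y / q ^ (N + 1) * q = y * q ^ (-(N : ℤ)) := by
    rw [zpow_neg, zpow_natCast, pow_succ]; field_simp
  rw [h1, h2]

theorem qPoch_mul_neg_zpow (q y : ℂ) (N m : ℕ) (hq : q ≠ 0) :
    qPoch q (y * q ^ (-((N + 1 : ℕ) : ℤ))) m * (1 - y * q ^ m / q ^ (N + 1)) =
      (1 - y / q ^ (N + 1)) * qPoch q (y * q ^ (-(N : ℤ))) m := by
  rw [← qPoch_mul_neg_zpow_succ q y N m hq, qPoch_succ, zpow_neg, zpow_natCast]
  congr 2
  ring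

theorem balancedFactor_mul (q b : ℂ) (N : ℕ) (x : ℂ) (m : ℕ) (hq : q ≠ 0) (hb : b ≠ 0)
    (hx : x ≠ 0) (h3 : ∀ s, 1 ≤ s → s ≤ N + 1 → b * x ≠ q ^ s) (hm : m ≤ N) :
    balancedFactor q b N x m * (x * q ^ m - q ^ (N + 1) / b) * (1 - q ^ (N + 1) / b * x) =
      balancedFactor q b (N + 1) x m * x := by
  have hQ : q ^ (N + 1) ≠ 0 := pow_ne_zero _ hq
  have h1 : 1 - b * x / q ^ (N + 1) ≠ 0 := by
    rw [sub_ne_zero, ne_comm, Ne, div_eq_one_iff_eq hQ]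
    exact h3 _ (by omega) le_rfl
  have h2 : 1 - b * x * q ^ m / q ^ (N + 1) ≠ 0 := by
    rw [sub_ne_zero, ne_comm, Ne, div_eq_one_iff_eq hQ]
    intro h
    refine h3 (N + 1 - m) (by omega) (by omega) (mul_right_cancel₀ (pow_ne_zero m hq) ?_)
    rw [h, ← pow_add]
    congr 1
    omega
  have e0 := qPoch_mul_neg_zpow q (b * x) N m hq
  unfold balancedFactor
  rw [qPoch_succ _ _ N, qPoch_succ _ _ N, eq_div_of_mul_eq h2 e0]
  have e1 : 1 - q * x / b * q ^ N = 1 - q ^ (N + 1) / b * x := by ring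
  have e2 : x * q ^ m - q ^ (N + 1) / b =
      -(1 - b * x * q ^ m / q ^ (N + 1)) * (q ^ (N + 1) / b) := by
    field_simp; ring
  have e3 : (1 - q / (b * x) * q ^ N) * x = -(1 - b * x / q ^ (N + 1)) * (q ^ (N + 1) / b) := by
    field_simp; ring
  rw [e1, e2]
  have alg : ∀ A B P P' α β γ δ v : ℂ, α ≠ 0 → δ ≠ 0 → β * x = -α * v →
      A * B / (P * P') * (-δ * v) * γ = A * β * (B * γ) / (α * P / δ * P') * x := by
    intro A B P P' α β γ δ v hα hδ h
    have : A * β * (B * γ) / (α * P / δ * P') * x =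
        A * B * γ * (β * x) / (α / δ) / (P * P') := by
      rw [div_div, show α * P / δ * P' = α / δ * (P * P') by ring]; ring
    rw [this, h]
    field_simp
  exact alg _ _ _ _ _ _ _ _ _ h1 h2 e3

theorem balancedFactor_succ (q b : ℂ) (N : ℕ) (x : ℂ) (m : ℕ) (hq : q ≠ 0) (hb : b ≠ 0)
    (hx : x ≠ 0) (h3 : b * x ≠ q ^ (N + 1)) (h4 : x * q ^ (m + 1) ≠ b) :
    balancedFactor q b N x m * (1 - q ^ (N + 1) / b * x) * (q ^ (N + 1) / b) =
      -balancedFactor q b (N + 1) x (m + 1) * x * (1 - x * q ^ (m + 1) / b) := by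
  have hQ : q ^ (N + 1) ≠ 0 := pow_ne_zero _ hq
  have h1 : 1 - b * x / q ^ (N + 1) ≠ 0 := by
    rw [sub_ne_zero, ne_comm, Ne, div_eq_one_iff_eq hQ]; exact h3
  have h2 : 1 - x * q ^ (m + 1) / b ≠ 0 := by
    rw [sub_ne_zero, ne_comm, Ne, div_eq_one_iff_eq hb]; exact h4
  unfold balancedFactor
  rw [qPoch_mul_neg_zpow_succ q (b * x) N m hq, qPoch_succ _ _ N, qPoch_succ _ _ N,
    qPoch_succ _ (q * x / b) m]
  have e1 : 1 - q * x / b * q ^ N = 1 - q ^ (N + 1) / b * x := by ring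
  have e2 : 1 - q * x / b * q ^ m = 1 - x * q ^ (m + 1) / b := by ring
  have e3 : (1 - q / (b * x) * q ^ N) * x = -(1 - b * x / q ^ (N + 1)) * (q ^ (N + 1) / b) := by
    field_simp; ring
  rw [e1, e2]
  have alg : ∀ A B P P' α β γ δ v : ℂ, α ≠ 0 → δ ≠ 0 → β * x = -α * v →
      A * B / (P * P') * γ * v = -(A * β * (B * γ) / (α * P * (P' * δ))) * x * δ := by
    intro A B P P' α β γ δ v hα hδ h
    have : -(A * β * (B * γ) / (α * P * (P' * δ))) * x * δ =
        -(A * B * γ * (β * x) / (α * δ) * δ / (P * P')) := by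
      rw [show α * P * (P' * δ) = α * δ * (P * P') by ring, ← div_div]; ring
    rw [this, h]
    field_simp
  exact alg _ _ _ _ _ _ _ _ _ h1 h2 e3

/-- The genericity conditions on `x` and `b` in the summation of length `N`. -/
structure GenericParams {n : ℕ} (q b : ℂ) (N : ℕ) (x : Fin n → ℂ) : Prop where
  ne_zero : ∀ i, x i ≠ 0
  injective : ∀ i j, i ≠ j → x i ≠ x j
  mul_ne : ∀ i j, i ≠ j → ∀ s < 2 * N, x i * x j * q ^ s ≠ 1
  shift_ne : ∀ i j, ∀ s, 1 ≤ s → s ≤ N → x i * q ^ s ≠ x j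
  lower_ne : ∀ i, ∀ s, 1 ≤ s → s ≤ N → b * x i ≠ q ^ s
  upper_ne : ∀ i, ∀ s, 1 ≤ s → s ≤ N → x i * q ^ s ≠ b

namespace GenericParams

variable {n : ℕ} {q b : ℂ} {N : ℕ} {x : Fin n → ℂ}

theorem of_succ (h : GenericParams q b (N + 1) x) : GenericParams q b N x where
  ne_zero := h.ne_zero
  injective := h.injective
  mul_ne i j hij s hs := h.mul_ne i j hij s (by omega)
  shift_ne i j s h1 hs := h.shift_ne i j s h1 (by omega)
  lower_ne i s h1 hs := h.lower_ne i s h1 (by omega)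
  upper_ne i s h1 hs := h.upper_ne i s h1 (by omega)

theorem node_ne (h : GenericParams q b N x) (hq : q ≠ 0) {k : Fin n → ℕ}
    (hk : ∀ i, k i ≤ N) {i j : Fin n} (hij : i ≠ j) : x i * q ^ k i ≠ x j * q ^ k j := by
  intro he
  wlog hle : k j ≤ k i generalizing i j
  · exact this hij.symm he.symm (by omega)
  obtain ⟨d, hd⟩ := Nat.exists_eq_add_of_le hle
  have : x i * q ^ d = x j := by
    refine mul_right_cancel₀ (pow_ne_zero (k j) hq) ?_
    rw [← he, hd, pow_add]; ring
  rcases Nat.eq_zero_or_pos d with h0 | h0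
  · subst h0
    exact h.injective i j hij (by simpa using this)
  · exact h.shift_ne i j d h0 (by have := hk i; omega) this

end GenericParams

/-- The coefficient of `symmetricBasis q x c (k + Pi.single i 1)` in the expansion of
`symmetricBasis q x c k * ∏ j, (1 - c j * v) * (1 - v / c j)`. -/
noncomputable def pieriCoeff {n : ℕ} (q v : ℂ) (x : Fin n → ℂ) (k : Fin n → ℕ) (i : Fin n) : ℂ :=
  v / (x i * q ^ k i) * ∏ j ∈ univ.erase i,
    ((1 - v * (x j * q ^ k j)) * (x j * q ^ k j - v) /
      ((x j * q ^ k j - x i * q ^ k i) * (1 - x i * q ^ k i * (x j * q ^ k j))))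

theorem symmetricBasis_mul_prod {n : ℕ} {q b : ℂ} {N : ℕ} {x : Fin n → ℂ}
    (h : GenericParams q b (N + 1) x) (hq : q ≠ 0) (c : Fin n → ℂ) (hc : ∀ i, c i ≠ 0)
    (v : ℂ) (hv : v ≠ 0) (k : Fin n → ℕ) (hk : ∑ i, k i ≤ N) :
    symmetricBasis q x c k * ∏ j, ((1 - c j * v) * (1 - v / c j)) =
      (∏ j, ((1 - v * (x j * q ^ k j)) * (1 - v / (x j * q ^ k j)))) * symmetricBasis q x c k +
        ∑ i, pieriCoeff q v x k i * symmetricBasis q x c (k + Pi.single i 1) := by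
  have hki : ∀ i, k i ≤ N := fun i =>
    (single_le_sum (fun _ _ => Nat.zero_le _) (mem_univ i)).trans hk
  rw [prod_quadratic_expansion (fun i => x i * q ^ k i) c v hv
    (fun i => mul_ne_zero (h.ne_zero i) (pow_ne_zero _ hq)) hc
    (fun i j hij => h.of_succ.node_ne hq hki hij)
    (fun i j hij => by
      rw [show x i * q ^ k i * (x j * q ^ k j) = x i * x j * q ^ (k i + k j) by
        rw [pow_add]; ring]
      exact h.mul_ne i j hij _ (by have := hki i; have := hki j; omega)),
    mul_add, mul_comm (symmetricBasis q x c k), mul_sum]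
  congr 1
  refine sum_congr rfl fun i _ => ?_
  rw [symmetricBasis_add_single, pieriCoeff]
  ring

theorem qPoch_neg_zpow_mul (q : ℂ) (N K : ℕ) (hq : q ≠ 0) :
    qPoch q (q ^ (-((N + 1 : ℕ) : ℤ))) K * (1 - q ^ K / q ^ (N + 1)) =
      (1 - 1 / q ^ (N + 1)) * qPoch q (q ^ (-(N : ℤ))) K := by
  simpa using qPoch_mul_neg_zpow q 1 N K hq

theorem qPoch_neg_zpow_succ (q : ℂ) (N K : ℕ) (hq : q ≠ 0) :
    qPoch q (q ^ (-((N + 1 : ℕ) : ℤ))) (K + 1) =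
      (1 - 1 / q ^ (N + 1)) * qPoch q (q ^ (-(N : ℤ))) K := by
  simpa using qPoch_mul_neg_zpow_succ q 1 N K hq

theorem qPoch_neg_zpow_self (q : ℂ) (N : ℕ) (hq : q ≠ 0) :
    qPoch q (q ^ (-(N : ℤ))) (N + 1) = 0 := by
  rw [qPoch_succ, zpow_neg, zpow_natCast, inv_mul_cancel₀ (pow_ne_zero _ hq), sub_self, mul_zero]

theorem balancedWeight_diagonal {n : ℕ} {q b : ℂ} {N : ℕ} {x : Fin n → ℂ}
    (h : GenericParams q b (N + 1) x) (hq : q ≠ 0) (hb : b ≠ 0) (k : Fin n → ℕ)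
    (hk : ∑ i, k i ≤ N + 1) :
    (1 - 1 / q ^ (N + 1)) * (∏ j, (1 - q ^ (N + 1) / b * x j)) *
        ((∏ j, ((1 - q ^ (N + 1) / b * (x j * q ^ k j)) *
          (1 - q ^ (N + 1) / b / (x j * q ^ k j)))) * balancedWeight q b N x k) =
      ((1 / q ^ (∑ i, k i) - 1 / q ^ (N + 1)) * ∏ j, (1 - q ^ (N + 1) / b * (x j * q ^ k j))) *
        balancedWeight q b (N + 1) x k := by
  have hQ : q ^ (N + 1) ≠ 0 := pow_ne_zero _ hq
  rcases hk.lt_or_eq with hlt | heq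
  · have hki : ∀ i, k i ≤ N := fun i =>
      (single_le_sum (fun _ _ => Nat.zero_le _) (mem_univ i)).trans (by omega)
    have hK : q ^ (∑ i, k i) ≠ 0 := pow_ne_zero _ hq
    have hp : (∏ j, (1 - q ^ (N + 1) / b * x j)) *
        (∏ j, (1 - q ^ (N + 1) / b / (x j * q ^ k j))) *
        (∏ j, balancedFactor q b N (x j) (k j)) * q ^ (∑ i, k i) =
        ∏ j, balancedFactor q b (N + 1) (x j) (k j) := by
      rw [← prod_pow_eq_pow_sum, ← prod_mul_distrib, ← prod_mul_distrib, ← prod_mul_distrib]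
      refine prod_congr rfl fun j _ => ?_
      have hxj := h.ne_zero j
      have hqj : q ^ k j ≠ 0 := pow_ne_zero _ hq
      refine mul_right_cancel₀ hxj ?_
      rw [← balancedFactor_mul q b N (x j) (k j) hq hb hxj (h.lower_ne j) (hki j)]
      field_simp
    unfold balancedWeight
    rw [← hp, prod_mul_distrib]
    have e0 := qPoch_neg_zpow_mul q N (∑ i, k i) hq
    have e1 : (1 / q ^ (∑ i, k i) - 1 / q ^ (N + 1)) * q ^ (∑ i, k i) =
        1 - q ^ (∑ i, k i) / q ^ (N + 1) := by field_simp
    generalize ∏ j, (1 - q ^ (N + 1) / b * x j) = X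
    generalize ∏ j, (1 - q ^ (N + 1) / b / (x j * q ^ k j)) = Y
    generalize ∏ j, (1 - q ^ (N + 1) / b * (x j * q ^ k j)) = Z
    generalize ∏ j, balancedFactor q b N (x j) (k j) = W
    generalize qPoch q (q ^ (-((N + 1 : ℕ) : ℤ))) (∑ i, k i) = P' at *
    generalize qPoch q (q ^ (-(N : ℤ))) (∑ i, k i) = P at *
    generalize q ^ (∑ i, k i) = s at *
    generalize q ^ (N + 1) = t at *
    linear_combination -X * Y * Z * W * s * e0 - X * Y * Z * W * s * P' * e1
  · unfold balancedWeight
    rw [heq, qPoch_neg_zpow_self q N hq]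
    simp

theorem weight_shift {n : ℕ} {q b : ℂ} {N : ℕ} {x : Fin n → ℂ}
    (h : GenericParams q b (N + 1) x) (hq : q ≠ 0) (hb : b ≠ 0) (k k' : Fin n → ℕ)
    (i : Fin n) (hkk : k = k' + Pi.single i 1) (hk : ∑ i, k' i ≤ N) :
    (1 - 1 / q ^ (N + 1)) * (∏ j, (1 - q ^ (N + 1) / b * x j)) *
        (pieriCoeff q (q ^ (N + 1) / b) x k' i *
          (vandermondeWeight q x k' * balancedWeight q b N x k')) =
      (∏ j, (x i * q ^ k i - x j)) /
          (x i * q ^ k i * ∏ j ∈ univ.erase i, (x i * q ^ k i - x j * q ^ k j)) *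
        (1 - q ^ (N + 1) / b * (x i * q ^ k i) * (1 / q ^ (N + 1))) *
        (∏ j ∈ univ.erase i, (1 - q ^ (N + 1) / b * (x j * q ^ k j))) *
        (vandermondeWeight q x k * balancedWeight q b (N + 1) x k) := by
  have hki' : ∀ i, k' i ≤ N := fun i =>
    (single_le_sum (fun _ _ => Nat.zero_le _) (mem_univ i)).trans hk
  have hsum : ∑ j, k j = ∑ j, k' j + 1 := by rw [hkk]; exact sum_add_single k' i
  have hki : ∀ i, k i ≤ N + 1 := fun i =>
    (single_le_sum (fun _ _ => Nat.zero_le _) (mem_univ i)).trans (by omega)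
  have hkii : k i = k' i + 1 := by simp [hkk]
  have hkj : ∀ j ∈ univ.erase i, k j = k' j := fun j hj => by
    simp [hkk, ne_of_mem_erase hj]
  have hxi := h.ne_zero i
  have hQ : q ^ (N + 1) ≠ 0 := pow_ne_zero _ hq
  have hV := vandermondeWeight_add_single q x k' i
    fun j hj => h.of_succ.node_ne hq hki' hj.symm
  rw [← hkk] at hV
  have hden : ∏ j, (1 - x i * q ^ (k' i + 1) / x j) ≠ 0 := by
    refine prod_ne_zero_iff.mpr fun j _ => ?_
    rw [sub_ne_zero, ne_comm, Ne, div_eq_one_iff_eq (h.ne_zero j)]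
    exact h.shift_ne i j _ (by omega) (by have := hki' i; omega)
  have hnum : ∏ j, (x i * q ^ k i - x j) = (∏ j, (1 - x i * q ^ (k' i + 1) / x j)) *
      (-x i * ∏ j ∈ univ.erase i, -x j) := by
    rw [mul_prod_erase univ (fun j => -x j) (mem_univ i), ← prod_mul_distrib, hkii]
    refine prod_congr rfl fun j _ => ?_
    have := h.ne_zero j
    field_simp
    ring
  have hM : balancedWeight q b (N + 1) x k = (1 - 1 / q ^ (N + 1)) *
      qPoch q (q ^ (-(N : ℤ))) (∑ j, k' j) * q ^ (∑ j, k' j + 1) *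
      (balancedFactor q b (N + 1) (x i) (k' i + 1) *
        ∏ j ∈ univ.erase i, balancedFactor q b (N + 1) (x j) (k' j)) := by
    unfold balancedWeight
    rw [hsum, qPoch_neg_zpow_succ q N _ hq, hkk,
      prod_add_single (fun j m => balancedFactor q b (N + 1) (x j) m)]
  have hM' : balancedWeight q b N x k' =
      qPoch q (q ^ (-(N : ℤ))) (∑ j, k' j) * q ^ (∑ j, k' j) *
      (balancedFactor q b N (x i) (k' i) *
        ∏ j ∈ univ.erase i, balancedFactor q b N (x j) (k' j)) := by
    unfold balancedWeight
    rw [mul_prod_erase univ (fun j => balancedFactor q b N (x j) (k' j)) (mem_univ i)]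
  have hτ := balancedFactor_succ q b N (x i) (k' i) hq hb hxi
    (h.lower_ne i _ (by omega) le_rfl)
    (h.upper_ne i _ (by omega) (by have := hki' i; omega))
  have hprod : (∏ j ∈ univ.erase i, (1 - q ^ (N + 1) / b * x j)) *
      (∏ j ∈ univ.erase i, ((1 - q ^ (N + 1) / b * (x j * q ^ k' j)) *
        (x j * q ^ k' j - q ^ (N + 1) / b) /
        ((x j * q ^ k' j - x i * q ^ k' i) * (1 - x i * q ^ k' i * (x j * q ^ k' j))))) *
      (∏ j ∈ univ.erase i, balancedFactor q b N (x j) (k' j)) =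
      (∏ j ∈ univ.erase i, -x j) / (∏ j ∈ univ.erase i, (x i * q ^ k i - x j * q ^ k j)) *
      (∏ j ∈ univ.erase i, (1 - q ^ (N + 1) / b * (x j * q ^ k j))) *
      (∏ j ∈ univ.erase i, (x i * q ^ (k' i + 1) - x j * q ^ k' j) /
        ((x i * q ^ k' i - x j * q ^ k' j) * (1 - x i * q ^ k' i * (x j * q ^ k' j)))) *
      ∏ j ∈ univ.erase i, balancedFactor q b (N + 1) (x j) (k' j) := by
    rw [← prod_div_distrib]
    simp only [← prod_mul_distrib]
    refine prod_congr rfl fun j hj => ?_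
    have hij := (ne_of_mem_erase hj).symm
    have h1 := sub_ne_zero.mpr (h.node_ne hq hki hij)
    have h2 := sub_ne_zero.mpr (h.of_succ.node_ne hq hki' hij)
    have h3 := sub_ne_zero.mpr (h.of_succ.node_ne hq hki' hij.symm)
    have hj1 := balancedFactor_mul q b N (x j) (k' j) hq hb (h.ne_zero j) (h.lower_ne j) (hki' j)
    rw [hkj j hj, hkii] at *
    have alg : ∀ X v z zi z' D τ τ' xj : ℂ, zi - z ≠ 0 → z' - z ≠ 0 → z - zi ≠ 0 →
        τ * (z - v) * X = τ' * xj →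
        X * ((1 - v * z) * (z - v) / ((z - zi) * D)) * τ =
          -xj / (z' - z) * (1 - v * z) * ((z' - z) / ((zi - z) * D)) * τ' := by
      intro X v z zi z' D τ τ' xj h1 h2 h3 h4
      have e1 : z - zi = -(zi - z) := by ring
      have e2 : X * ((1 - v * z) * (z - v) / ((z - zi) * D)) * τ =
          (τ * (z - v) * X) * (1 - v * z) / ((z - zi) * D) := by ring
      rw [e2, h4, e1, ← div_div, ← div_div (z' - z)]
      field_simp
    exact alg _ _ _ _ _ _ _ _ _ h2 h1 h3 hj1
  have hvQ : q ^ (N + 1) / b * (x i * q ^ k i) * (1 / q ^ (N + 1)) =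
      x i * q ^ (k' i + 1) / b := by
    rw [hkii]; field_simp
  rw [hV, hM, hM', hnum, hvQ, pieriCoeff, ← mul_prod_erase univ _ (mem_univ i), hkii]
  rw [hkii] at hprod
  generalize ∏ j, (1 - x i * q ^ (k' i + 1) / x j) = A at *
  generalize ∏ j ∈ univ.erase i, (1 - q ^ (N + 1) / b * x j) = P1 at *
  generalize ∏ j ∈ univ.erase i, ((1 - q ^ (N + 1) / b * (x j * q ^ k' j)) *
        (x j * q ^ k' j - q ^ (N + 1) / b) /
        ((x j * q ^ k' j - x i * q ^ k' i) * (1 - x i * q ^ k' i * (x j * q ^ k' j)))) = P2 at *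
  generalize ∏ j ∈ univ.erase i, balancedFactor q b N (x j) (k' j) = P3 at *
  generalize ∏ j ∈ univ.erase i, balancedFactor q b (N + 1) (x j) (k' j) = P4 at *
  generalize ∏ j ∈ univ.erase i, -x j = P5 at *
  generalize ∏ j ∈ univ.erase i, (x i * q ^ (k' i + 1) - x j * q ^ k j) = P6 at *
  generalize ∏ j ∈ univ.erase i, (1 - q ^ (N + 1) / b * (x j * q ^ k j)) = P7 at *
  generalize ∏ j ∈ univ.erase i, (x i * q ^ (k' i + 1) - x j * q ^ k' j) /
    ((x i * q ^ k' i - x j * q ^ k' j) * (1 - x i * q ^ k' i * (x j * q ^ k' j))) = P8 at *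
  generalize balancedFactor q b N (x i) (k' i) = τ at *
  generalize balancedFactor q b (N + 1) (x i) (k' i + 1) = τ' at *
  generalize vandermondeWeight q x k' = V at *
  generalize qPoch q (q ^ (-(N : ℤ))) (∑ j, k' j) = W at *
  rw [pow_succ q (∑ j, k' j), pow_succ q (k' i), ← mul_assoc (x i)] at *
  generalize q ^ (∑ j, k' j) = s at *
  have hz : x i * q ^ k' i ≠ 0 := mul_ne_zero hxi (pow_ne_zero _ hq)
  generalize x i * q ^ k' i = z at *
  generalize q ^ (N + 1) / b = v at *
  generalize 1 - 1 / q ^ (N + 1) = Q at *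
  have goal_l : Q * ((1 - v * x i) * P1) * (v / z * P2 * (V * (W * s * (τ * P3)))) =
      Q * V * W * s / z * (τ * (1 - v * x i) * v) * (P1 * P2 * P3) := by ring
  have goal_r : A * (-x i * P5) / (z * q * P6) * (1 - z * q / b) * P7 *
      (V * P8 * A⁻¹ * (Q * W * (s * q) * (τ' * P4))) =
      (A * A⁻¹) * (q / q) * (Q * V * W * s / z) * (-τ' * x i * (1 - z * q / b)) *
        (P5 / P6 * P7 * P8 * P4) := by ring
  rw [goal_l, goal_r, hprod, hτ, mul_inv_cancel₀ hden, div_self hq]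
  ring

theorem weight_recurrence {n : ℕ} {q b : ℂ} {N : ℕ} {x : Fin n → ℂ}
    (h : GenericParams q b (N + 1) x) (hq : q ≠ 0) (hqru : ∀ m : ℕ, 0 < m → q ^ m ≠ 1)
    (hb : b ≠ 0) (k : Fin n → ℕ) (hk : ∑ i, k i ≤ N + 1) :
    vandermondeWeight q x k * balancedWeight q b (N + 1) x k =
      (∏ j, ((1 - q ^ (N + 1) / b * (x j * q ^ k j)) * (1 - q ^ (N + 1) / b / (x j * q ^ k j)))) *
          (vandermondeWeight q x k * balancedWeight q b N x k) +
        ∑ i, if 0 < k i then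
          pieriCoeff q (q ^ (N + 1) / b) x (k - Pi.single i 1) i *
            (vandermondeWeight q x (k - Pi.single i 1) *
              balancedWeight q b N x (k - Pi.single i 1)) else 0 := by
  have hQ : q ^ (N + 1) ≠ 0 := pow_ne_zero _ hq
  have hki : ∀ i, k i ≤ N + 1 := fun i =>
    (single_le_sum (fun _ _ => Nat.zero_le _) (mem_univ i)).trans hk
  have hC : (1 - 1 / q ^ (N + 1)) * (∏ j, (1 - q ^ (N + 1) / b * x j)) ≠ 0 := by
    refine mul_ne_zero ?_ (prod_ne_zero_iff.mpr fun j _ => ?_)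
    · rw [sub_ne_zero, ne_comm, Ne, div_eq_one_iff_eq hQ]
      exact (hqru _ (by omega)).symm
    · rw [sub_ne_zero, ne_comm, div_mul_eq_mul_div, Ne, div_eq_one_iff_eq hb, mul_comm]
      exact h.upper_ne j _ (by omega) le_rfl
  refine mul_left_cancel₀ hC ?_
  rw [mul_add, mul_left_comm _ (vandermondeWeight q x k) (balancedWeight q b N x k),
    mul_left_comm _ (vandermondeWeight q x k) (_ * balancedWeight q b N x k),
    balancedWeight_diagonal h hq hb k hk, mul_sum]
  have hterm : ∀ i, (1 - 1 / q ^ (N + 1)) * (∏ j, (1 - q ^ (N + 1) / b * x j)) *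
      (if 0 < k i then
          pieriCoeff q (q ^ (N + 1) / b) x (k - Pi.single i 1) i *
            (vandermondeWeight q x (k - Pi.single i 1) *
              balancedWeight q b N x (k - Pi.single i 1)) else 0) =
      (∏ j, (x i * q ^ k i - x j)) /
          (x i * q ^ k i * ∏ j ∈ univ.erase i, (x i * q ^ k i - x j * q ^ k j)) *
        (1 - q ^ (N + 1) / b * (x i * q ^ k i) * (1 / q ^ (N + 1))) *
        (∏ j ∈ univ.erase i, (1 - q ^ (N + 1) / b * (x j * q ^ k j))) *
        (vandermondeWeight q x k * balancedWeight q b (N + 1) x k) := fun i => by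
    split_ifs with hi
    · have hkk : k = (k - Pi.single i 1) + Pi.single i 1 := by
        funext j
        rcases eq_or_ne j i with rfl | hj
        · simp; omega
        · simp [hj]
      refine weight_shift h hq hb k _ i hkk ?_
      have := sum_add_single (k - Pi.single i 1) i
      rw [← hkk] at this
      omega
    · have hi0 : k i = 0 := by omega
      have : ∏ j, (x i * q ^ k i - x j) = 0 :=
        prod_eq_zero (mem_univ i) (by rw [hi0]; ring)
      rw [this]; ring
  rw [sum_congr rfl fun i _ => hterm i, ← sum_mul,
    prod_linear_expansion (fun i => x i * q ^ k i) x (q ^ (N + 1) / b) (1 / q ^ (N + 1))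
      (1 / q ^ (∑ i, k i)) (div_ne_zero hQ hb)
      (fun i => mul_ne_zero (h.ne_zero i) (pow_ne_zero _ hq))
      (fun i j hij => h.node_ne hq hki hij)
      (by
        have := pow_ne_zero (∑ i, k i) hq
        rw [prod_mul_distrib, prod_pow_eq_pow_sum]
        field_simp)]
  ring

/-- The multi-indices `k` with `|k| ≤ N`. -/
def multiIndices (n N : ℕ) : Finset (Fin n → ℕ) :=
  {k ∈ Fintype.piFinset fun _ => range (N + 1) | ∑ i, k i ≤ N}

theorem mem_multiIndices {n N : ℕ} {k : Fin n → ℕ} : k ∈ multiIndices n N ↔ ∑ i, k i ≤ N := by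
  simp only [multiIndices, mem_filter, Fintype.mem_piFinset, mem_range, and_iff_right_iff_imp]
  exact fun hk i => Nat.lt_succ_of_le
    ((single_le_sum (fun _ _ => Nat.zero_le _) (mem_univ i)).trans hk)

theorem sum_multiIndices_shift {n : ℕ} (N : ℕ) (f : (Fin n → ℕ) → (Fin n → ℕ) → ℂ) (i : Fin n) :
    ∑ k ∈ multiIndices n N, f k (k + Pi.single i 1) =
      ∑ k ∈ multiIndices n (N + 1), if 0 < k i then f (k - Pi.single i 1) k else 0 := by
  have hsub : ∀ k : Fin n → ℕ, 0 < k i → k - Pi.single i 1 + Pi.single i 1 = k := fun k hk => by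
    funext j
    rcases eq_or_ne j i with rfl | hj
    · simp; omega
    · simp [hj]
  rw [← sum_filter]
  refine sum_bij' (fun k _ => k + Pi.single i 1) (fun k _ => k - Pi.single i 1) ?_ ?_ ?_ ?_ ?_
  · intro k hk
    rw [mem_multiIndices] at hk
    rw [mem_filter, mem_multiIndices, sum_add_single]
    exact ⟨by omega, by simp⟩
  · intro k hk
    rw [mem_filter, mem_multiIndices] at hk
    rw [mem_multiIndices]
    have := sum_add_single (k - Pi.single i 1) i
    rw [hsub k hk.2] at this
    omega
  · intro k _
    simp
  · intro k hk
    exact hsub k (mem_filter.mp hk).2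
  · intro k _
    simp

theorem sum_weight_mul_symmetricBasis {n : ℕ} {q b : ℂ} {x : Fin n → ℂ} (hq : q ≠ 0)
    (hqru : ∀ m : ℕ, 0 < m → q ^ m ≠ 1) (hb : b ≠ 0) (c : Fin n → ℂ) (hc : ∀ i, c i ≠ 0) (N : ℕ)
    (h : GenericParams q b N x) :
    ∑ k ∈ multiIndices n N,
        vandermondeWeight q x k * balancedWeight q b N x k * symmetricBasis q x c k =
      ∏ j, (qPoch q (q * c j / b) N * qPoch q (q / (c j * b)) N) := by
  induction N with
  | zero =>
    have h0 : multiIndices n 0 = {0} := by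
      ext k
      simp [mem_multiIndices, funext_iff]
    have hV : vandermondeWeight q x 0 = 1 := by
      unfold vandermondeWeight
      simp only [Pi.zero_apply, qPoch_zero, pow_zero, mul_one, inv_one, prod_const_one, add_zero]
      refine prod_eq_one fun i _ => prod_eq_one fun j _ => ?_
      split_ifs with hij
      · exact div_self (sub_ne_zero.mpr (h.injective i j hij.ne))
      · rfl
    rw [h0, sum_singleton, hV]
    simp [balancedWeight, balancedFactor, symmetricBasis, qPoch_zero]
  | succ N ih =>
    have hv : q ^ (N + 1) / b ≠ 0 := div_ne_zero (pow_ne_zero _ hq) hb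
    have hF : ∏ j, (qPoch q (q * c j / b) (N + 1) * qPoch q (q / (c j * b)) (N + 1)) =
        (∏ j, (qPoch q (q * c j / b) N * qPoch q (q / (c j * b)) N)) *
          ∏ j, ((1 - c j * (q ^ (N + 1) / b)) * (1 - q ^ (N + 1) / b / c j)) := by
      rw [← prod_mul_distrib]
      refine prod_congr rfl fun j _ => ?_
      have := hc j
      rw [qPoch_succ, qPoch_succ]
      have e1 : q * c j / b * q ^ N = c j * (q ^ (N + 1) / b) := by ring
      have e2 : q / (c j * b) * q ^ N = q ^ (N + 1) / b / c j := by field_simp; ring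
      rw [e1, e2]; ring
    rw [hF, ← ih h.of_succ, sum_mul]
    set v := q ^ (N + 1) / b with hv_def
    set w : (Fin n → ℕ) → ℂ := fun k => vandermondeWeight q x k * balancedWeight q b N x k with hw
    have hexp : ∀ k ∈ multiIndices n N,
        vandermondeWeight q x k * balancedWeight q b N x k * symmetricBasis q x c k *
          ∏ j, ((1 - c j * v) * (1 - v / c j)) =
        (∏ j, ((1 - v * (x j * q ^ k j)) * (1 - v / (x j * q ^ k j)))) * w k *
            symmetricBasis q x c k +
          ∑ i, pieriCoeff q v x k i * w k * symmetricBasis q x c (k + Pi.single i 1) :=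
      fun k hk => by
        rw [mul_assoc, symmetricBasis_mul_prod h hq c hc v hv k (mem_multiIndices.mp hk),
          mul_add, mul_sum]
        congr 1
        · ring
        · exact sum_congr rfl fun i _ => by ring
    rw [sum_congr rfl hexp, sum_add_distrib, sum_comm]
    have hdiag : ∑ k ∈ multiIndices n N,
        (∏ j, ((1 - v * (x j * q ^ k j)) * (1 - v / (x j * q ^ k j)))) * w k *
          symmetricBasis q x c k = ∑ k ∈ multiIndices n (N + 1),
        (∏ j, ((1 - v * (x j * q ^ k j)) * (1 - v / (x j * q ^ k j)))) * w k *
          symmetricBasis q x c k := by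
      refine sum_subset (fun k hk => ?_) fun k hk hk' => ?_
      · rw [mem_multiIndices] at *; omega
      · rw [mem_multiIndices] at *
        have hK : ∑ i, k i = N + 1 := by omega
        simp only [hw, balancedWeight, hK, qPoch_neg_zpow_self q N hq, zero_mul, mul_zero]
    rw [hdiag, sum_congr rfl fun i _ => sum_multiIndices_shift N
      (fun k k' => pieriCoeff q v x k i * w k * symmetricBasis q x c k') i, sum_comm,
      ← sum_add_distrib]
    refine sum_congr rfl fun k hk => ?_
    rw [weight_recurrence h hq hqru hb k (mem_multiIndices.mp hk), add_mul, sum_mul]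
    congr 1
    refine sum_congr rfl fun i _ => ?_
    split_ifs
    · rfl
    · rw [zero_mul]

/-- Mixed-type terminating balanced `₃φ₂` summation of Milne–Lilly. -/
theorem stmt_15 (n : ℕ) (hn : 0 < n) (N : ℕ) (q : ℂ) (hq : q ≠ 0)
    (hqru : ∀ m : ℕ, 0 < m → q ^ m ≠ 1)
    (a : Fin n → ℂ) (b : ℂ) (x : Fin n → ℂ)
    (ha : ∀ i, a i ≠ 0) (hb : b ≠ 0) (hx : ∀ i, x i ≠ 0)
    (hxd : ∀ i j : Fin n, i ≠ j → x i ≠ x j)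
    (hd1 : ∀ i j : Fin n, i < j → ∀ m ≤ 2 * N, qPoch q (x i * x j) m ≠ 0)
    (hd2 : ∀ i j : Fin n, ∀ m ≤ N, qPoch q (q * x i / x j) m ≠ 0)
    (hd3 : ∀ i : Fin n, ∀ m ≤ N, qPoch q (b * x i * q ^ (-(N : ℤ))) m ≠ 0)
    (hd4 : ∀ i : Fin n, ∀ m ≤ N, qPoch q (q * x i / b) m ≠ 0)
    (hd5 : ∀ i : Fin n, qPoch q (q / (b * x i)) N ≠ 0) :
    ∑ k ∈ Finset.filter (fun k : Fin n → ℕ => ∑ i, k i ≤ N)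
        (Fintype.piFinset fun _ => Finset.range (N + 1)),
      ((∏ i, ∏ j, if i < j then
          (x i * q ^ k i - x j * q ^ k j) / (x i - x j) *
            (qPoch q (x i * x j) (k i + k j))⁻¹ else 1) *
        (∏ i, ∏ j, qPoch q (a j * x i / x j) (k i) * qPoch q (x i * x j / a j) (k i) /
          qPoch q (q * x i / x j) (k i)) *
        (qPoch q (q ^ (-(N : ℤ))) (∑ i, k i) /
          ∏ i, qPoch q (b * x i * q ^ (-(N : ℤ))) (k i) * qPoch q (q * x i / b) (k i)) *
        q ^ (∑ i, k i)) =
      ∏ i, qPoch q (q * a i / (b * x i)) N * qPoch q (q * x i / (a i * b)) N /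
        (qPoch q (q / (b * x i)) N * qPoch q (q * x i / b) N) := by
  have hlower : ∀ i, ∀ s, 1 ≤ s → s ≤ N → b * x i ≠ q ^ s := fun i s hs1 hs he => by
    refine qPoch_ne_zero_iff.mp (hd5 i) (s - 1) (by omega) ?_
    rw [he, div_mul_eq_mul_div, ← pow_succ', Nat.sub_add_cancel hs1, div_self (pow_ne_zero _ hq)]
  have hgen : GenericParams q b N x :=
    { ne_zero := hx
      injective := hxd
      mul_ne := fun i j hij s hs => by
        rcases lt_or_gt_of_ne hij with hlt | hlt
        · exact qPoch_ne_zero_iff.mp (hd1 i j hlt _ le_rfl) s hs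
        · rw [mul_comm (x i)]
          exact qPoch_ne_zero_iff.mp (hd1 j i hlt _ le_rfl) s hs
      shift_ne := fun i j s hs1 hs he => by
        refine qPoch_ne_zero_iff.mp (hd2 i j N le_rfl) (s - 1) (by omega) ?_
        rw [← he, div_mul_eq_mul_div, mul_right_comm, ← pow_succ', Nat.sub_add_cancel hs1,
          mul_comm, div_self (mul_ne_zero (hx i) (pow_ne_zero _ hq))]
      lower_ne := hlower
      upper_ne := fun i s hs1 hs he => by
        refine qPoch_ne_zero_iff.mp (hd4 i N le_rfl) (s - 1) (by omega) ?_
        rw [← he, div_mul_eq_mul_div, mul_right_comm, ← pow_succ', Nat.sub_add_cancel hs1,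
          mul_comm, div_self (mul_ne_zero (hx i) (pow_ne_zero _ hq))] }
  have hD : ∏ i, (qPoch q (q / (b * x i)) N * qPoch q (q * x i / b) N) ≠ 0 :=
    prod_ne_zero_iff.mpr fun i _ => mul_ne_zero (hd5 i) (hd4 i N le_rfl)
  have hmain := sum_weight_mul_symmetricBasis hq hqru hb (fun j => a j / x j)
    (fun j => div_ne_zero (ha j) (hx j)) N hgen
  rw [prod_div_distrib, eq_div_iff hD, sum_mul]
  convert hmain using 1
  · refine sum_congr rfl fun k _ => ?_
    unfold vandermondeWeight balancedWeight balancedFactor symmetricBasis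
    have e1 : ∀ i j : Fin n, a j / x j * x i = a j * x i / x j := fun i j => by ring
    have e2 : ∀ i j : Fin n, x i / (a j / x j) = x i * x j / a j := fun i j => by
      rw [div_div_eq_mul_div]
    simp only [e1, e2, div_eq_mul_inv _ (qPoch _ _ _), prod_mul_distrib, prod_div_distrib]
    ring
  · refine prod_congr rfl fun j _ => ?_
    have := ha j; have := hx j
    congr 2
    · field_simp
    · field_simp
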